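/- Let F be a finite field with q elements, and let K, D, L be positive integers with 1 ≤ L ≤ D ≤ K; set T = K - D + 1. Let X : Ω → F^K be uniformly distributed on F^K, let Q be a random variable with finite range that is independent of X, and let A be a random variable with finite range. Suppose that for every i ∈ {1, ..., T} there exists an L × D matrix V_i over F, every L × L submatrix of which is invertible, such that H(Z_i | (A, Q)) = 0, where Z_i = V_i · (X_i, X_{i+1}, ..., X_{i+D-1})ᵀ. Then H(A) ≥ (K - D + L) · log q. -/

import Mathlib

/-- The probability that a random variable `Y` on a finite probability space with mass
function `p` takes the value `s`. -/
noncomputable def prob {Ω S : Type*} [Fintype Ω] [DecidableEq S]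
    (p : Ω → ℝ) (Y : Ω → S) (s : S) : ℝ :=
  ∑ ω ∈ Finset.univ.filter (fun ω => Y ω = s), p ω

/-- The Shannon entropy `H(Y) = -∑_s P(Y = s) log P(Y = s)` of a random variable `Y`
with finite range. -/
noncomputable def entropy {Ω S : Type*} [Fintype Ω] [Fintype S] [DecidableEq S]
    (p : Ω → ℝ) (Y : Ω → S) : ℝ :=
  ∑ s : S, -(prob p Y s * Real.log (prob p Y s))

/-- The conditional Shannon entropy `H(Z | Y) = H(Z, Y) - H(Y)`. -/
noncomputable def condEntropy {Ω S T : Type*} [Fintype Ω] [Fintype S] [DecidableEq S]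
    [Fintype T] [DecidableEq T] (p : Ω → ℝ) (Z : Ω → S) (Y : Ω → T) : ℝ :=
  entropy p (fun ω => (Z ω, Y ω)) - entropy p Y

section Prob

variable {Ω S T : Type*} [Fintype Ω] [DecidableEq S] [DecidableEq T] {p : Ω → ℝ}

theorem prob_nonneg (hp : ∀ ω, 0 ≤ p ω) (Y : Ω → S) (s : S) : 0 ≤ prob p Y s :=
  Finset.sum_nonneg fun ω _ => hp ω

theorem sum_prob [Fintype S] (p : Ω → ℝ) (Y : Ω → S) : ∑ s, prob p Y s = ∑ ω, p ω :=
  Finset.sum_fiberwise Finset.univ Y p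

theorem sum_prob_pair_left [Fintype S] (p : Ω → ℝ) (Z : Ω → S) (Y : Ω → T) (t : T) :
    ∑ s, prob p (fun ω => (Z ω, Y ω)) (s, t) = prob p Y t := by
  unfold prob
  rw [← Finset.sum_fiberwise (Finset.univ.filter fun ω => Y ω = t) Z p]
  refine Finset.sum_congr rfl fun s _ => ?_
  rw [Finset.filter_filter]
  refine Finset.sum_congr (Finset.filter_congr fun ω _ => ?_) fun _ _ => rfl
  simp [and_comm]

theorem sum_prob_pair_right [Fintype T] (p : Ω → ℝ) (Z : Ω → S) (Y : Ω → T) (s : S) :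
    ∑ t, prob p (fun ω => (Z ω, Y ω)) (s, t) = prob p Z s := by
  unfold prob
  rw [← Finset.sum_fiberwise (Finset.univ.filter fun ω => Z ω = s) Y p]
  refine Finset.sum_congr rfl fun t _ => ?_
  rw [Finset.filter_filter]
  refine Finset.sum_congr (Finset.filter_congr fun ω _ => ?_) fun _ _ => rfl
  simp

theorem prob_pair_le (hp : ∀ ω, 0 ≤ p ω) (Z : Ω → S) (Y : Ω → T) (s : S) (t : T) :
    prob p (fun ω => (Z ω, Y ω)) (s, t) ≤ prob p Y t := by
  refine Finset.sum_le_sum_of_subset_of_nonneg (fun ω hω => ?_) fun ω _ _ => hp ω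
  simp_all

theorem condEntropy_eq_sum [Fintype S] [Fintype T] (p : Ω → ℝ) (Z : Ω → S) (Y : Ω → T) :
    condEntropy p Z Y = ∑ st : S × T, prob p (fun ω => (Z ω, Y ω)) st *
      (Real.log (prob p Y st.2) - Real.log (prob p (fun ω => (Z ω, Y ω)) st)) := by
  have h : entropy p Y = ∑ st : S × T,
      -(prob p (fun ω => (Z ω, Y ω)) st * Real.log (prob p Y st.2)) := by
    rw [Fintype.sum_prod_type_right, entropy]
    refine Finset.sum_congr rfl fun t _ => ?_
    simp only [Finset.sum_neg_distrib, ← Finset.sum_mul, sum_prob_pair_left]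
  rw [condEntropy, h, entropy, ← Finset.sum_sub_distrib]
  exact Finset.sum_congr rfl fun st _ => by ring

/-- If `H(Z | Y) = 0`, then `Y` determines `Z` on the support of the mass function. -/
theorem eq_of_condEntropy_eq_zero [Fintype S] [Fintype T] (hp : ∀ ω, 0 ≤ p ω)
    {Z : Ω → S} {Y : Ω → T} (h : condEntropy p Z Y = 0) {ω ω' : Ω}
    (hω : 0 < p ω) (hω' : 0 < p ω') (hY : Y ω = Y ω') : Z ω = Z ω' := by
  have hpos : 0 < prob p (fun ω => (Z ω, Y ω)) (Z ω, Y ω) :=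
    hω.trans_le (Finset.single_le_sum (f := p) (fun i _ => hp i) (by simp))
  rw [condEntropy_eq_sum, Finset.sum_eq_zero_iff_of_nonneg] at h
  · have h1 := h (Z ω, Y ω) (Finset.mem_univ _)
    have hle := prob_pair_le hp Z Y (Z ω) (Y ω)
    have heq : prob p Y (Y ω) = prob p (fun ω => (Z ω, Y ω)) (Z ω, Y ω) :=
      Real.log_injOn_pos (hpos.trans_le hle) hpos
        (sub_eq_zero.1 ((mul_eq_zero.1 h1).resolve_left hpos.ne'))
    by_contra hne
    refine absurd heq (ne_of_gt ?_)
    refine Finset.sum_lt_sum_of_subset (i := ω') (fun ν hν => ?_) ?_ ?_ hω' fun ν _ _ => hp ν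
    · simp_all
    · simp [hY]
    · simp [Ne.symm hne]
  · rintro ⟨s, t⟩ -
    rcases (prob_nonneg hp (fun ω => (Z ω, Y ω)) (s, t)).eq_or_lt with h0 | h0
    · simp [← h0]
    · exact mul_nonneg h0.le
        (sub_nonneg.2 (Real.log_le_log h0 (prob_pair_le hp Z Y s t)))

/-- A random variable all of whose atoms have mass at most `c` has entropy at least
`-log c`. -/
theorem neg_log_le_entropy [Fintype S] (hp : ∀ ω, 0 ≤ p ω) (hp1 : ∑ ω, p ω = 1)
    {Y : Ω → S} {c : ℝ} (h : ∀ s, prob p Y s ≤ c) : -Real.log c ≤ entropy p Y := by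
  have h1 : -Real.log c = ∑ s, prob p Y s * -Real.log c := by
    rw [← Finset.sum_mul, sum_prob, hp1, one_mul]
  rw [h1, entropy]
  refine Finset.sum_le_sum fun s _ => ?_
  rcases (prob_nonneg hp Y s).eq_or_lt with h0 | h0
  · simp [← h0]
  · rw [← mul_neg]
    exact mul_le_mul_of_nonneg_left (neg_le_neg (Real.log_le_log h0 (h s))) h0.le

/-- If `X` takes only values in `B` when `Y = t`, up to null outcomes, then
`P(Y = t) ≤ ∑_{x ∈ B} P(X = x, Q = r)` whenever `Y = t` implies `Q = r`. -/
theorem prob_le_sum_prob_pair {R : Type*} [DecidableEq R] (hp : ∀ ω, 0 ≤ p ω)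
    {X : Ω → S} {Y : Ω → T} {Q : Ω → R} {t : T} {r : R} {B : Finset S}
    (hQ : ∀ ω, Y ω = t → Q ω = r) (hB : ∀ ω, 0 < p ω → Y ω = t → X ω ∈ B) :
    prob p Y t ≤ ∑ x ∈ B, prob p (fun ω => (X ω, Q ω)) (x, r) := by
  simp only [prob, Finset.sum_filter]
  rw [Finset.sum_comm]
  refine Finset.sum_le_sum fun ω _ => ?_
  have hnn : ∀ x ∈ B, 0 ≤ if (X ω, Q ω) = (x, r) then p ω else 0 := fun x _ => by
    split_ifs
    exacts [hp ω, le_rfl]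
  by_cases hY : Y ω = t
  · rw [if_pos hY]
    rcases (hp ω).eq_or_lt with h0 | h0
    · exact h0.ge.trans (Finset.sum_nonneg hnn)
    · simpa [hQ ω hY] using Finset.single_le_sum hnn (hB ω h0 hY)
  · rw [if_neg hY]
    exact Finset.sum_nonneg hnn

end Prob

section MDS

variable {F : Type*} [Field F] {D L : ℕ}

/-- A vector in the kernel of an `L × D` MDS matrix vanishes as soon as its first `D - L`
coordinates do. -/
theorem eq_zero_of_mulVec_eq_zero_of_mds (hLD : L ≤ D) {V : Matrix (Fin L) (Fin D) F}
    (hV : ∀ g : Fin L → Fin D, Function.Injective g → IsUnit (V.submatrix id g))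
    {d : Fin D → F} (hd : ∀ j : Fin D, (j : ℕ) < D - L → d j = 0)
    (h : V.mulVec d = 0) : d = 0 := by
  let g : Fin L → Fin D := fun l => ⟨D - L + l, by omega⟩
  have hg : Function.Injective g := fun a b hab => by
    have := congrArg Fin.val hab
    simp only [g] at this
    exact Fin.ext (by omega)
  have hsub : (V.submatrix id g).mulVec (d ∘ g) = 0 := by
    rw [← h]
    ext r
    simp only [Matrix.mulVec, dotProduct, Matrix.submatrix_apply, id, Function.comp]
    refine Fintype.sum_of_injective g hg _ _ (fun j hj => ?_) fun _ => rfl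
    rw [hd j, mul_zero]
    by_contra hlt
    exact hj ⟨⟨j - (D - L), by omega⟩, Fin.ext (by simp only [g]; omega)⟩
  have hdg : d ∘ g = 0 :=
    Matrix.mulVec_injective_of_isUnit (hV g hg) (by rw [hsub, Matrix.mulVec_zero])
  ext j
  by_cases hj : (j : ℕ) < D - L
  · exact hd j hj
  · have := congrFun hdg ⟨j - (D - L), by omega⟩
    simpa [g, Nat.add_sub_cancel' (not_lt.1 hj)] using this

/-- A vector all of whose windows of length `D` lie in the kernels of MDS matrices vanishes
as soon as its first `D - L` coordinates do. -/
theorem eq_zero_of_window_mulVec_eq_zero {K : ℕ} (hL : 1 ≤ L) (hLD : L ≤ D) (hDK : D ≤ K)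
    {V : Fin (K - D + 1) → Matrix (Fin L) (Fin D) F}
    (hV : ∀ i, ∀ g : Fin L → Fin D, Function.Injective g → IsUnit ((V i).submatrix id g))
    {d : Fin K → F} (hd : ∀ k : Fin K, (k : ℕ) < D - L → d k = 0)
    (h : ∀ i, (V i).mulVec (fun j : Fin D => d ⟨(i : ℕ) + (j : ℕ), by omega⟩) = 0) :
    d = 0 := by
  suffices H : ∀ n : ℕ, ∀ hn : n < K, d ⟨n, hn⟩ = 0 from funext fun k => H k k.2
  intro n
  induction n using Nat.strong_induction_on with
  | _ n ih =>
    intro hn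
    by_cases hnL : n < D - L
    · exact hd _ hnL
    by_cases hnD : n < D
    · have := congrFun (eq_zero_of_mulVec_eq_zero_of_mds hLD (hV 0)
        (fun j hj => hd _ (by simpa using hj)) (h 0)) ⟨n, hnD⟩
      simpa using this
    · have := congrFun (eq_zero_of_mulVec_eq_zero_of_mds hLD (hV ⟨n - (D - 1), by omega⟩)
        (fun j hj => ih _ (by simp only; omega) _) (h ⟨n - (D - 1), by omega⟩)) ⟨D - 1, by omega⟩
      simpa [Nat.sub_add_cancel (show D - 1 ≤ n by omega)] using this

end MDS

/-- converse bound: let `1 ≤ L ≤ D ≤ K`, `T = K - D + 1`, `X` uniform on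
`F^K`, `Q` independent of `X`, and `A` a random variable with finite range. If for every
`i ∈ {1, ..., T}` there is an `L × D` MDS matrix `V_i` (every `L × L` submatrix
invertible) with `H(V_i · X_{W_i} | (A, Q)) = 0`, where `W_i = {i, ..., i + D - 1}`,
then `H(A) ≥ (K - D + L) · log q`. -/
theorem stmt_5 {F : Type*} [Field F] [Fintype F] [DecidableEq F]
    {Ω AT QT : Type*} [Fintype Ω] [Fintype AT] [DecidableEq AT]
    [Fintype QT] [DecidableEq QT]
    (p : Ω → ℝ) (hp : ∀ ω, 0 ≤ p ω) (hp1 : ∑ ω, p ω = 1)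
    (K D L : ℕ) (hL : 1 ≤ L) (hLD : L ≤ D) (hDK : D ≤ K)
    (X : Ω → (Fin K → F))
    (hX : ∀ x : Fin K → F, prob p X x = 1 / (Fintype.card F : ℝ) ^ K)
    (Q : Ω → QT) (A : Ω → AT)
    (hQX : ∀ (x : Fin K → F) (qv : QT),
      prob p (fun ω => (X ω, Q ω)) (x, qv) = prob p X x * prob p Q qv)
    (hZ : ∀ i : Fin (K - D + 1), ∃ V : Matrix (Fin L) (Fin D) F,
      (∀ g : Fin L → Fin D, Function.Injective g → IsUnit (V.submatrix id g)) ∧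
      condEntropy p
        (fun ω => V.mulVec (fun j : Fin D =>
          X ω ⟨(i : ℕ) + (j : ℕ), by have := i.isLt; have := j.isLt; omega⟩))
        (fun ω => (A ω, Q ω)) = 0) :
    ((K - D + L : ℕ) : ℝ) * Real.log (Fintype.card F) ≤ entropy p A := by
  classical
  choose V hV hVZ using hZ
  set q : ℝ := (Fintype.card F : ℝ)
  have hq : 0 < q := Nat.cast_pos.2 Fintype.card_pos
  have hkey : ∀ a r, prob p (fun ω => (A ω, Q ω)) (a, r) ≤
      (q ^ (K - D + L))⁻¹ * prob p Q r := by
    intro a r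
    let B : Finset (Fin K → F) :=
      Finset.univ.filter fun x => ∃ ω, 0 < p ω ∧ (A ω, Q ω) = (a, r) ∧ X ω = x
    have hB : B.card ≤ Fintype.card F ^ (D - L) := by
      let e : (Fin K → F) → (Fin (D - L) → F) := fun x j => x ⟨j, by omega⟩
      have hinj : Set.InjOn e B := by
        intro x hx y hy hxy
        obtain ⟨ω, hω, hωY, rfl⟩ := (Finset.mem_filter.1 hx).2
        obtain ⟨ω', hω', hωY', rfl⟩ := (Finset.mem_filter.1 hy).2
        refine sub_eq_zero.1 (eq_zero_of_window_mulVec_eq_zero hL hLD hDK hV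
          (fun k hk => sub_eq_zero.2 (congrFun hxy ⟨k, hk⟩)) fun i => ?_)
        have := eq_of_condEntropy_eq_zero hp (hVZ i) hω hω' (hωY.trans hωY'.symm)
        rw [← sub_eq_zero, ← Matrix.mulVec_sub] at this
        exact this
      calc B.card ≤ (Finset.univ : Finset (Fin (D - L) → F)).card :=
            Finset.card_le_card_of_injOn e (fun _ _ => Finset.mem_coe.2 (Finset.mem_univ _)) hinj
        _ = Fintype.card F ^ (D - L) := by simp
    calc prob p (fun ω => (A ω, Q ω)) (a, r)
        ≤ ∑ x ∈ B, prob p (fun ω => (X ω, Q ω)) (x, r) :=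
          prob_le_sum_prob_pair hp (fun ω h => (Prod.ext_iff.1 h).2)
            fun ω h0 h => Finset.mem_filter.2 ⟨Finset.mem_univ _, ω, h0, h, rfl⟩
      _ = B.card * ((q ^ K)⁻¹ * prob p Q r) := by simp [hQX, hX, q]
      _ ≤ q ^ (D - L) * ((q ^ K)⁻¹ * prob p Q r) := by
          refine mul_le_mul_of_nonneg_right (by simp only [q]; exact_mod_cast hB) ?_
          have := prob_nonneg hp Q r
          positivity
      _ = (q ^ (K - D + L))⁻¹ * prob p Q r := by
          rw [show K = (D - L) + (K - D + L) by omega, pow_add]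
          rw [show D - L + (K - D + L) - D + L = K - D + L by omega]
          field_simp
  have hA : ∀ a, prob p A a ≤ (q ^ (K - D + L))⁻¹ := by
    intro a
    calc prob p A a = ∑ r, prob p (fun ω => (A ω, Q ω)) (a, r) :=
          (sum_prob_pair_right p A Q a).symm
      _ ≤ ∑ r, (q ^ (K - D + L))⁻¹ * prob p Q r := Finset.sum_le_sum fun r _ => hkey a r
      _ = (q ^ (K - D + L))⁻¹ := by rw [← Finset.mul_sum, sum_prob, hp1, mul_one]
  simpa [Real.log_inv, Real.log_pow] using neg_log_le_entropy hp hp1 hA
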